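/- Let M be a monoid. Then M satisfies the right Ore condition if and only if for every indecomposable right M-set X, every nonempty sub-M-set of X is itself an indecomposable right M-set. -/

import Mathlib

/-- `S` is a sub-`M`-set of the right `M`-set `X`. -/
def IsSubMSet (M : Type*) [Monoid M] {X : Type*} [MulAction Mᵐᵒᵖ X] (S : Set X) : Prop :=
  ∀ x ∈ S, ∀ m : M, MulOpposite.op m • x ∈ S

/-- Two elements of a right `M`-set are connected: related by the equivalence relation
generated by the pairs `(x, x · m)`. -/
def MConn (M : Type*) [Monoid M] {X : Type*} [MulAction Mᵐᵒᵖ X] (a b : X) : Prop :=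
  Relation.EqvGen (fun x y => ∃ m : M, y = MulOpposite.op m • x) a b

/-- A right `M`-set is indecomposable if nonempty and any two elements are connected. -/
def MIndec (M : Type*) [Monoid M] (X : Type*) [MulAction Mᵐᵒᵖ X] : Prop :=
  Nonempty X ∧ ∀ a b : X, MConn M a b

/-- The right Ore condition for a monoid `M`. -/
def RightOre (M : Type*) [Monoid M] : Prop :=
  ∀ m₁ m₂ : M, ∃ n₁ n₂ : M, m₁ * n₁ = m₂ * n₂

/-- Under the right Ore condition, connected elements have a common translate. -/
theorem RightOre.exists_smul_eq_smul {M X : Type*} [Monoid M] [MulAction Mᵐᵒᵖ X]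
    (hM : RightOre M) {a b : X} (h : MConn M a b) :
    ∃ m n : M, MulOpposite.op m • a = MulOpposite.op n • b := by
  induction h with
  | rel x y h =>
    obtain ⟨m, rfl⟩ := h
    exact ⟨m, 1, by simp⟩
  | refl x => exact ⟨1, 1, rfl⟩
  | symm x y _ ih =>
    obtain ⟨m, n, h⟩ := ih
    exact ⟨n, m, h.symm⟩
  | trans x y z _ _ ih₁ ih₂ =>
    obtain ⟨m, n, h⟩ := ih₁
    obtain ⟨p, q, h'⟩ := ih₂
    obtain ⟨r, s, hrs⟩ := hM n p
    refine ⟨m * r, q * s, ?_⟩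
    rw [MulOpposite.op_mul, MulOpposite.op_mul, mul_smul, mul_smul, h, ← h', ← mul_smul,
      ← mul_smul, ← MulOpposite.op_mul, ← MulOpposite.op_mul, hrs]

/-- A monoid is indecomposable as a right set over itself. -/
theorem MIndec.self (M : Type*) [Monoid M] : MIndec M M :=
  have conn_one (a : M) : MConn M 1 a := .rel _ _ ⟨a, by simp⟩
  ⟨⟨1⟩, fun a b => .trans _ _ _ (.symm _ _ (conn_one a)) (conn_one b)⟩

theorem stmt10 (M : Type u) [Monoid M] :
    RightOre M ↔
      ∀ (X : Type u) [MulAction Mᵐᵒᵖ X], MIndec M X →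
        ∀ S : Set X, IsSubMSet M S → S.Nonempty →
          -- `S`, with the restricted action, is an indecomposable right `M`-set:
          (Nonempty S ∧ ∀ a b : S,
            Relation.EqvGen (fun x y : S => ∃ m : M, (y : X) = MulOpposite.op m • (x : X)) a b) := by
  constructor
  · intro hM X _ hX S hS hne
    refine ⟨hne.to_subtype, fun a b => ?_⟩
    obtain ⟨m, n, h⟩ := hM.exists_smul_eq_smul (hX.2 a b)
    exact .trans _ ⟨MulOpposite.op m • (a : X), hS a a.2 m⟩ _ (.rel _ _ ⟨m, rfl⟩)
      (.symm _ _ (.rel _ _ ⟨n, h⟩))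
  · intro H m₁ m₂
    by_contra! hne
    let S : Set M := {x | (∃ n, x = m₁ * n) ∨ ∃ n, x = m₂ * n}
    have hS : IsSubMSet M S := by
      rintro x (⟨n, rfl⟩ | ⟨n, rfl⟩) m
      · exact .inl ⟨n * m, by simp [mul_assoc]⟩
      · exact .inr ⟨n * m, by simp [mul_assoc]⟩
    have h₁ : m₁ ∈ S := .inl ⟨1, by simp⟩
    have h₂ : m₂ ∈ S := .inr ⟨1, by simp⟩
    have mem_iff {a b : S}
        (h : Relation.EqvGen
          (fun x y : S => ∃ m : M, (y : M) = MulOpposite.op m • (x : M)) a b) :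
        (∃ n, (a : M) = m₁ * n) ↔ ∃ n, (b : M) = m₁ * n := by
      induction h with
      | rel x y h =>
        obtain ⟨m, hm⟩ := h
        rw [MulOpposite.smul_eq_mul_unop, MulOpposite.unop_op] at hm
        constructor
        · rintro ⟨n, hn⟩
          exact ⟨n * m, by rw [hm, hn, mul_assoc]⟩
        · rintro ⟨n, hn⟩
          rcases x.2 with hx | ⟨k, hk⟩
          · exact hx
          · exact absurd (by rw [← hn, hm, hk, mul_assoc]) (hne n (k * m))
      | refl x => rfl
      | symm x y _ ih => exact ih.symm
      | trans x y z _ _ ih₁ ih₂ => exact ih₁.trans ih₂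
    obtain ⟨n, hn⟩ :=
      (mem_iff ((H M (MIndec.self M) S hS ⟨m₁, h₁⟩).2 ⟨m₁, h₁⟩ ⟨m₂, h₂⟩)).1 ⟨1, by simp⟩
    exact hne n 1 (by rw [mul_one]; exact hn.symm)
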